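/- arXiv:2308.14764 — 2 statements merged into one kernel-verified Lean document; each statement's English description precedes it below -/
import Mathlib

section
/- Let n be a positive integer, let α ∈ (1, p(n)), and let f : (0,∞) → ℝ be a C² function such that t ↦ t^{−α} f(t) is non-increasing on (0,∞). Then every positive solution of Δu + f(u) = 0 on all of ℝⁿ is constant. -/
open Set Metric

/-- Euclidean space ℝⁿ. -/
abbrev E (n : ℕ) := EuclideanSpace ℝ (Fin n)

/-- The Laplacian of `u : ℝⁿ → ℝ`: the sum of its second partial derivatives. -/
noncomputable def lap {n : ℕ} (u : E n → ℝ) (x : E n) : ℝ :=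
  ∑ i : Fin n,
    iteratedFDeriv ℝ 2 u x ![EuclideanSpace.single i 1, EuclideanSpace.single i 1]

open Filter Topology

section PartialDerivatives

variable {n : ℕ}

/-- The standard basis vector `e i` of `ℝⁿ`. -/
noncomputable abbrev stdVec (i : Fin n) : E n := EuclideanSpace.single i 1

/-- The partial derivative of `w` in the `i`-th coordinate direction. -/
noncomputable def pd (i : Fin n) (w : E n → ℝ) (x : E n) : ℝ :=
  fderiv ℝ w x (stdVec i)

/-- The forward difference quotient of `w` with step `h` in the `i`-th coordinate direction. -/
noncomputable def diffQuot (h : ℝ) (i : Fin n) (w : E n → ℝ) (x : E n) : ℝ :=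
  (w (x + h • stdVec i) - w x) / h

theorem ContDiff.pd {w : E n → ℝ} {m : ℕ} (hw : ContDiff ℝ (m + 1) w) (i : Fin n) :
    ContDiff ℝ m (pd i w) :=
  (hw.fderiv_right le_rfl).clm_apply contDiff_const

theorem ContDiff.diffQuot {w : E n → ℝ} {m : ℕ} (hw : ContDiff ℝ m w) (h : ℝ) (i : Fin n) :
    ContDiff ℝ m (diffQuot h i w) :=
  ((hw.comp (contDiff_id.add contDiff_const)).sub hw).div_const h

theorem lap_eq_sum_pd {w : E n → ℝ} (hw : ContDiff ℝ 2 w) (x : E n) :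
    lap w x = ∑ i, pd i (pd i w) x := by
  have hd : DifferentiableAt ℝ (fderiv ℝ w) x :=
    (hw.fderiv_right (m := 1) (by norm_num)).differentiable (by norm_num) x
  refine Finset.sum_congr rfl fun i _ => ?_
  have h : pd i w = fun y => fderiv ℝ w y (stdVec i) := rfl
  rw [iteratedFDeriv_two_apply, h, pd, fderiv_clm_apply hd (differentiableAt_const _)]
  simp

theorem pd_add {a b : E n → ℝ} (ha : Differentiable ℝ a) (hb : Differentiable ℝ b) (k : Fin n) :
    pd k (fun x => a x + b x) = fun x => pd k a x + pd k b x := by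
  funext x
  simp [pd, fderiv_fun_add (ha x) (hb x)]

theorem pd_neg (a : E n → ℝ) (k : Fin n) :
    pd k (fun x => -a x) = fun x => -pd k a x := by
  funext x
  simp [pd, fderiv_fun_neg]

theorem pd_mul {a b : E n → ℝ} (ha : Differentiable ℝ a) (hb : Differentiable ℝ b) (k : Fin n) :
    pd k (fun x => a x * b x) = fun x => a x * pd k b x + pd k a x * b x := by
  funext x
  simp [pd, fderiv_fun_mul (ha x) (hb x), mul_comm]

theorem pd_sq {a : E n → ℝ} (ha : Differentiable ℝ a) (k : Fin n) :
    pd k (fun x => a x ^ 2) = fun x => 2 * a x * pd k a x := by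
  simp only [sq, pd_mul ha ha]
  funext x
  ring

theorem pd_sum {ι : Type*} {s : Finset ι} {a : ι → E n → ℝ}
    (ha : ∀ i, Differentiable ℝ (a i)) (k : Fin n) :
    pd k (fun x => ∑ i ∈ s, a i x) = fun x => ∑ i ∈ s, pd k (a i) x := by
  funext x
  simp [pd, fderiv_fun_sum fun i _ => ha i x]

theorem pd_comp {φ : ℝ → ℝ} {a : E n → ℝ} {x : E n} (hφ : DifferentiableAt ℝ φ (a x))
    (ha : DifferentiableAt ℝ a x) (k : Fin n) :
    pd k (fun x => φ (a x)) x = deriv φ (a x) * pd k a x := by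
  have h : HasFDerivAt (fun x => φ (a x)) (deriv φ (a x) • fderiv ℝ a x) x :=
    hφ.hasDerivAt.comp_hasFDerivAt x ha.hasFDerivAt
  simp [pd, h.fderiv]

theorem pd_diffQuot {w : E n → ℝ} (hw : Differentiable ℝ w) (h : ℝ) (i k : Fin n) :
    pd k (diffQuot h i w) = diffQuot h i (pd k w) := by
  funext x
  have h1 : HasFDerivAt (fun y => w (y + h • stdVec i)) (fderiv ℝ w (x + h • stdVec i)) x :=
    (hasFDerivAt_comp_add_right _).2 (hw _).hasFDerivAt
  have h2 : HasFDerivAt (diffQuot h i w)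
      (h⁻¹ • (fderiv ℝ w (x + h • stdVec i) - fderiv ℝ w x)) x := by
    have := (h1.sub (hw x).hasFDerivAt).const_smul h⁻¹
    refine this.congr_of_eventuallyEq (Eventually.of_forall fun y => ?_)
    simp [diffQuot, div_eq_inv_mul]
  rw [pd, h2.fderiv]
  simp [diffQuot, pd, div_eq_inv_mul]

theorem pd_pd_mul {a b : E n → ℝ} (ha : ContDiff ℝ 2 a) (hb : ContDiff ℝ 2 b) (k : Fin n) :
    pd k (pd k (fun x => a x * b x)) = fun x =>
      a x * pd k (pd k b) x + 2 * (pd k a x * pd k b x) + pd k (pd k a) x * b x := by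
  have da := ha.differentiable (by norm_num)
  have db := hb.differentiable (by norm_num)
  have da' : Differentiable ℝ (pd k a) := (ContDiff.pd (m := 1) ha k).differentiable (by norm_num)
  have db' : Differentiable ℝ (pd k b) := (ContDiff.pd (m := 1) hb k).differentiable (by norm_num)
  rw [pd_mul da db, pd_add (da.fun_mul db') (da'.fun_mul db), pd_mul da db', pd_mul da' db]
  funext x
  ring

theorem IsLocalMax.pd_eq_zero {φ : E n → ℝ} {x : E n} (h : IsLocalMax φ x) (k : Fin n) :
    pd k φ x = 0 := by
  simp [pd, h.fderiv_eq_zero]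

theorem IsLocalMax.deriv_deriv_nonpos {φ : ℝ → ℝ} {a : ℝ} (h : IsLocalMax φ a)
    (hc : ContinuousAt φ a) : deriv (deriv φ) a ≤ 0 := by
  by_contra! hpos
  have hmin := isLocalMin_of_deriv_deriv_pos hpos h.deriv_eq_zero hc
  have hconst : φ =ᶠ[𝓝 a] fun _ => φ a := by
    filter_upwards [h, hmin] with y h1 h2 using le_antisymm h1 h2
  have := hconst.deriv.deriv_eq
  simp at this
  linarith

theorem IsLocalMax.pd_pd_nonpos {φ : E n → ℝ} {x : E n} (h : IsLocalMax φ x)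
    (hφ : ContDiff ℝ 2 φ) (k : Fin n) : pd k (pd k φ) x ≤ 0 := by
  have hline (t : ℝ) : HasDerivAt (fun s : ℝ => x + s • stdVec k) (stdVec k) t := by
    simpa using ((hasDerivAt_id t).smul_const (stdVec k)).const_add x
  have key {ψ : E n → ℝ} (hψ : Differentiable ℝ ψ) :
      deriv (fun s : ℝ => ψ (x + s • stdVec k)) = fun s => pd k ψ (x + s • stdVec k) := by
    funext t
    exact ((hψ _).hasFDerivAt.comp_hasDerivAt t (hline t)).deriv
  have hcont : Continuous fun s : ℝ => x + s • stdVec k := by fun_prop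
  have hmax : IsLocalMax (fun s : ℝ => φ (x + s • stdVec k)) 0 := by
    have ht : Tendsto (fun s : ℝ => x + s • stdVec k) (𝓝 0) (𝓝 x) := by
      simpa using hcont.tendsto 0
    simpa [IsLocalMax, IsMaxFilter] using ht.eventually h
  have := hmax.deriv_deriv_nonpos (hφ.continuous.comp hcont).continuousAt
  rw [key (hφ.differentiable (by norm_num)),
    key ((ContDiff.pd (m := 1) hφ k).differentiable (by norm_num))] at this
  simpa using this

theorem tendsto_diffQuot {w : E n → ℝ} (hw : ContDiff ℝ 1 w) {x : ℕ → E n} {a : E n} {h : ℕ → ℝ}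
    (hx : Tendsto x atTop (𝓝 a)) (hh : Tendsto h atTop (𝓝 0)) (h0 : ∀ m, h m ≠ 0) (i : Fin n) :
    Tendsto (fun m => diffQuot (h m) i w (x m)) atTop (𝓝 (pd i w a)) := by
  have hs : HasStrictFDerivAt w (fderiv ℝ w a) a :=
    hw.contDiffAt.hasStrictFDerivAt (by norm_num)
  have ht : Tendsto (fun m => (x m + h m • stdVec i, x m)) atTop (𝓝 (a, a)) := by
    refine Tendsto.prodMk_nhds ?_ hx
    simpa using hx.add (hh.smul_const (stdVec i))
  have hO := hs.isLittleO.comp_tendsto ht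
  have hO' : (fun m => w (x m + h m • stdVec i) - w (x m) - h m * pd i w a)
      =o[atTop] h := by
    refine (hO.trans_le fun m => ?_).congr_left fun m => ?_
    · simp [norm_smul]
    · simp [pd]
  have hlim := hO'.tendsto_div_nhds_zero.add_const (pd i w a)
  rw [zero_add] at hlim
  refine hlim.congr fun m => ?_
  have := h0 m
  simp only [diffQuot]
  field_simp
  ring

end PartialDerivatives

section MaximumPrinciple

variable {n : ℕ}

theorem pd_sum_sq_diffQuot {w : E n → ℝ} (hw : ContDiff ℝ 1 w) (h : ℝ) (k : Fin n) :
    pd k (fun x => ∑ i, diffQuot h i w x ^ 2) =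
      fun x => ∑ i, 2 * diffQuot h i w x * diffQuot h i (pd k w) x := by
  have hd (i : Fin n) : Differentiable ℝ (diffQuot h i w) :=
    (ContDiff.diffQuot (m := 1) hw h i).differentiable (by norm_num)
  rw [pd_sum fun i => (hd i).fun_pow 2]
  simp only [pd_sq (hd _), pd_diffQuot (hw.differentiable (by norm_num))]

theorem pd_pd_sum_sq_diffQuot {w : E n → ℝ} (hw : ContDiff ℝ 2 w) (h : ℝ) (k : Fin n) :
    pd k (pd k (fun x => ∑ i, diffQuot h i w x ^ 2)) =
      fun x => ∑ i, (2 * diffQuot h i (pd k w) x ^ 2 +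
        2 * (diffQuot h i w x * diffQuot h i (pd k (pd k w)) x)) := by
  have hw' : ContDiff ℝ 1 (pd k w) := ContDiff.pd (m := 1) hw k
  have hd (i : Fin n) : Differentiable ℝ (diffQuot h i w) :=
    (ContDiff.diffQuot (m := 2) hw h i).differentiable (by norm_num)
  have hd' (i : Fin n) : Differentiable ℝ (diffQuot h i (pd k w)) :=
    (ContDiff.diffQuot (m := 1) hw' h i).differentiable (by norm_num)
  rw [pd_sum_sq_diffQuot (hw.of_le (by norm_num))]
  rw [pd_sum fun i => ((hd i).const_mul 2).fun_mul (hd' i)]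
  funext x
  refine Finset.sum_congr rfl fun i _ => ?_
  have e : (fun x => 2 * diffQuot h i w x) = fun x => diffQuot h i w x + diffQuot h i w x := by
    funext x; ring
  rw [pd_mul ((hd i).const_mul 2) (hd' i), e, pd_add (hd i) (hd i),
    pd_diffQuot (hw'.differentiable (by norm_num)), pd_diffQuot (hw.differentiable (by norm_num))]
  ring

theorem sum_diffQuot_pd_pd {w g : E n → ℝ} (hg : ∀ x, ∑ k, pd k (pd k w) x = g x)
    (h : ℝ) (i : Fin n) (x : E n) :
    ∑ k, diffQuot h i (pd k (pd k w)) x = diffQuot h i g x := by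
  simp only [diffQuot, ← hg, ← Finset.sum_div, Finset.sum_sub_distrib]

/-- The first and second order conditions at a maximum of `η |∇w|²`, for `w` of class `C²` whose
Laplacian `g` is of class `C¹`: no third derivatives of `w` are needed, since one may differentiate
the difference quotients of `w` instead. -/
theorem exists_max_mul_sq_grad {w g η : E n → ℝ} (hw : ContDiff ℝ 2 w) (hgc : ContDiff ℝ 1 g)
    (hη : ContDiff ℝ 2 η) (hg : ∀ x, ∑ k, pd k (pd k w) x = g x) {p : E n} {R : ℝ}
    (hR : 0 < R) (hη0 : ∀ x, dist x p = R → η x = 0) (hp : 0 < η p * ∑ i, pd i w p ^ 2) :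
    ∃ x ∈ ball p R, η p * ∑ i, pd i w p ^ 2 ≤ η x * ∑ i, pd i w x ^ 2 ∧
      (∀ k, η x * ∑ i, 2 * pd i w x * pd i (pd k w) x + pd k η x * ∑ i, pd i w x ^ 2 = 0) ∧
      η x * (∑ k, ∑ i, 2 * pd i (pd k w) x ^ 2 + ∑ i, 2 * (pd i w x * pd i g x)) +
        2 * ∑ k, pd k η x * ∑ i, 2 * pd i w x * pd i (pd k w) x +
        (∑ k, pd k (pd k η) x) * ∑ i, pd i w x ^ 2 ≤ 0 := by
  set h : ℕ → ℝ := fun m => 1 / ((m : ℝ) + 1) with h_def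
  have h0 (m : ℕ) : h m ≠ 0 := by positivity
  have hh : Tendsto h atTop (𝓝 0) := tendsto_one_div_add_atTop_nhds_zero_nat
  set q : ℕ → E n → ℝ := fun m x => ∑ i, diffQuot (h m) i w x ^ 2 with q_def
  have hw1 : ContDiff ℝ 1 w := hw.of_le (by norm_num)
  have hwk (k : Fin n) : ContDiff ℝ 1 (pd k w) := ContDiff.pd (m := 1) hw k
  have hq (m : ℕ) : ContDiff ℝ 2 (q m) :=
    ContDiff.sum fun i _ => (ContDiff.diffQuot (m := 2) hw (h m) i).pow 2
  have hF (m : ℕ) : ContDiff ℝ 2 (fun x => η x * q m x) := hη.mul (hq m)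
  have hmax (m : ℕ) := (isCompact_closedBall p R).exists_isMaxOn
    ⟨p, mem_closedBall_self hR.le⟩ (hF m).continuous.continuousOn
  choose y hyB hy using hmax
  obtain ⟨a, haB, φ, hφ, hya⟩ := (isCompact_closedBall p R).tendsto_subseq hyB
  have hhφ : Tendsto (h ∘ φ) atTop (𝓝 0) := hh.comp hφ.tendsto_atTop
  have lim {v : E n → ℝ} (hv : ContDiff ℝ 1 v) (i : Fin n) :
      Tendsto (fun m => diffQuot (h (φ m)) i v (y (φ m))) atTop (𝓝 (pd i v a)) :=
    tendsto_diffQuot hv hya hhφ (fun m => h0 _) i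
  have limc {v : E n → ℝ} (hv : Continuous v) :
      Tendsto (fun m => v (y (φ m))) atTop (𝓝 (v a)) := (hv.tendsto a).comp hya
  have hle : η p * ∑ i, pd i w p ^ 2 ≤ η a * ∑ i, pd i w a ^ 2 := by
    have hl : Tendsto (fun m => η p * q (φ m) p) atTop (𝓝 (η p * ∑ i, pd i w p ^ 2)) :=
      (tendsto_finsetSum _ fun i _ =>
        (tendsto_diffQuot hw1 tendsto_const_nhds hhφ (fun m => h0 _) i).pow 2).const_mul _
    have hr : Tendsto (fun m => η (y (φ m)) * q (φ m) (y (φ m))) atTop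
        (𝓝 (η a * ∑ i, pd i w a ^ 2)) :=
      (limc hη.continuous).mul (tendsto_finsetSum _ fun i _ => (lim hw1 i).pow 2)
    exact le_of_tendsto_of_tendsto' hl hr fun m => hy (φ m) (mem_closedBall_self hR.le)
  have haR : a ∈ ball p R := by
    rcases (mem_closedBall.1 haB).lt_or_eq with hlt | heq
    · exact hlt
    · rw [hη0 a heq] at hle
      linarith
  have hloc : ∀ᶠ m in atTop, IsLocalMax (fun x => η x * q (φ m) x) (y (φ m)) := by
    filter_upwards [hya.eventually (isOpen_ball.mem_nhds haR)] with m hm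
    exact (hy (φ m)).isLocalMax
      (mem_of_superset (isOpen_ball.mem_nhds hm) ball_subset_closedBall)
  have hηk (k : Fin n) : ContDiff ℝ 1 (pd k η) := ContDiff.pd (m := 1) hη k
  have hηkk (k : Fin n) : Continuous (pd k (pd k η)) :=
    (ContDiff.pd (m := 0) (by simpa using hηk k) k).continuous
  have limq : Tendsto (fun m => q (φ m) (y (φ m))) atTop (𝓝 (∑ i, pd i w a ^ 2)) :=
    tendsto_finsetSum _ fun i _ => (lim hw1 i).pow 2
  have limqk (k : Fin n) : Tendsto (fun m => pd k (q (φ m)) (y (φ m))) atTop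
      (𝓝 (∑ i, 2 * pd i w a * pd i (pd k w) a)) := by
    simp only [q_def, pd_sum_sq_diffQuot hw1]
    exact tendsto_finsetSum _ fun i _ => ((lim hw1 i).const_mul 2).mul (lim (hwk k) i)
  have limqkk : Tendsto (fun m => ∑ k, pd k (pd k (q (φ m))) (y (φ m))) atTop
      (𝓝 (∑ k, ∑ i, 2 * pd i (pd k w) a ^ 2 + ∑ i, 2 * (pd i w a * pd i g a))) := by
    have e (m : ℕ) (x : E n) : ∑ k, pd k (pd k (q m)) x =
        ∑ k, ∑ i, 2 * diffQuot (h m) i (pd k w) x ^ 2 +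
          ∑ i, 2 * (diffQuot (h m) i w x * diffQuot (h m) i g x) := by
      simp only [q_def, pd_pd_sum_sq_diffQuot hw, Finset.sum_add_distrib]
      congr 1
      rw [Finset.sum_comm]
      simp only [← Finset.mul_sum, sum_diffQuot_pd_pd hg]
    simp only [e]
    exact (tendsto_finsetSum _ fun k _ => tendsto_finsetSum _ fun i _ =>
      ((lim (hwk k) i).pow 2).const_mul 2).add
      (tendsto_finsetSum _ fun i _ => ((lim hw1 i).mul (lim hgc i)).const_mul 2)
  refine ⟨a, haR, hle, fun k => ?_, ?_⟩
  · refine tendsto_nhds_unique_of_eventuallyEq (((limc hη.continuous).mul (limqk k)).add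
      ((limc (hηk k).continuous).mul limq)) tendsto_const_nhds ?_
    filter_upwards [hloc] with m hm
    have := hm.pd_eq_zero k
    rwa [pd_mul (hη.differentiable (by norm_num)) ((hq _).differentiable (by norm_num))] at this
  · refine le_of_tendsto ((((limc hη.continuous).mul limqkk).add
      ((tendsto_finsetSum Finset.univ fun k _ =>
        (limc (hηk k).continuous).mul (limqk k)).const_mul 2)).add
      ((tendsto_finsetSum Finset.univ fun k _ => limc (hηkk k)).mul limq)) ?_
    filter_upwards [hloc] with m hm
    have := Finset.sum_nonpos fun k (_ : k ∈ Finset.univ) => hm.pd_pd_nonpos (hF _) k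
    simp only [pd_pd_mul hη (hq _), Finset.sum_add_distrib, ← Finset.mul_sum,
      ← Finset.sum_mul] at this
    exact this

end MaximumPrinciple

/-- A refined trace inequality for a square matrix `A` with trace `T` and Rayleigh quotient `a` in
the direction `v`. -/
theorem sq_add_mul_sq_le_sum_sq {n : ℕ} (A : Fin n → Fin n → ℝ) (v : Fin n → ℝ) {q a κ : ℝ}
    (hv : ∑ i, v i ^ 2 = q) (hq : 0 < q) (ha : ∑ k, ∑ i, v k * v i * A k i = a * q)
    (hκ : 0 ≤ κ) (hκn : κ * ((n : ℝ) - 1) ≤ 1) :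
    a ^ 2 + κ * (∑ k, A k k - a) ^ 2 ≤ ∑ k, ∑ i, A k i ^ 2 := by
  set T := ∑ k, A k k with T_def
  set s := κ * (T - a) with s_def
  let d : Fin n → Fin n → ℝ := fun k i => if k = i then 1 else 0
  have hpos : 0 ≤ ∑ k, ∑ i, (A k i - (a - s) / q * (v k * v i) - s * d k i) ^ 2 := by positivity
  have e (k i : Fin n) : (A k i - (a - s) / q * (v k * v i) - s * d k i) ^ 2 =
      A k i ^ 2 + ((a - s) / q) ^ 2 * (v k ^ 2 * v i ^ 2) + s ^ 2 * d k i
        - 2 * ((a - s) / q) * (v k * v i * A k i) - 2 * s * (A k i * d k i)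
        + 2 * ((a - s) / q) * s * (v k * v i * d k i) := by
    have hd : d k i ^ 2 = d k i := by
      simp only [d]; split_ifs <;> norm_num
    linear_combination s ^ 2 * hd
  have e1 : ∑ k, v k ^ 2 * ∑ i, v i ^ 2 = q ^ 2 := by
    rw [← Finset.sum_mul, hv, sq]
  have e2 : ∑ k, ∑ i, d k i = n := by simp [d]
  have e3 : ∑ k, ∑ i, A k i * d k i = T := by simp [d, T_def]
  have e4 : ∑ k, ∑ i, v k * v i * d k i = q := by simp [d, ← hv, sq]
  simp only [e, Finset.sum_add_distrib, Finset.sum_sub_distrib, ← Finset.mul_sum, e1, e2, e3, e4,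
    ha] at hpos
  have hsimp : ∑ k, ∑ i, A k i ^ 2 + ((a - s) / q) ^ 2 * q ^ 2 + s ^ 2 * n
        - 2 * ((a - s) / q) * (a * q) - 2 * s * T + 2 * ((a - s) / q) * s * q =
      ∑ k, ∑ i, A k i ^ 2 - a ^ 2 + s ^ 2 * (n - 1) - 2 * s * (T - a) := by
    field_simp
    ring
  rw [hsimp] at hpos
  have : s ^ 2 * ((n : ℝ) - 1) ≤ κ * (T - a) ^ 2 := by
    have : s ^ 2 * ((n : ℝ) - 1) = κ * (T - a) ^ 2 * (κ * ((n : ℝ) - 1)) := by rw [s_def]; ring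
    rw [this]
    exact mul_le_of_le_one_right (by positivity) hκn
  have : s * (T - a) = κ * (T - a) ^ 2 := by rw [s_def]; ring
  linarith

section Cutoff

variable {n : ℕ}

theorem pd_coord_sub (p : E n) (k i : Fin n) :
    pd k (fun x : E n => x i - p i) = fun _ => if i = k then 1 else 0 := by
  funext x
  have h : HasFDerivAt (fun x : E n => x i - p i) (EuclideanSpace.proj (𝕜 := ℝ) i) x :=
    (EuclideanSpace.proj i : E n →L[ℝ] ℝ).hasFDerivAt.sub_const (p i)
  simp [pd, h.fderiv]

theorem contDiff_coord_sub (p : E n) (i : Fin n) :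
    ContDiff ℝ 2 (fun x : E n => x i - p i) :=
  (EuclideanSpace.proj i : E n →L[ℝ] ℝ).contDiff.sub contDiff_const

/-- The quadratic `R² - |x - p|²`. -/
noncomputable def quadCutoff (p : E n) (R : ℝ) (x : E n) : ℝ :=
  -∑ i, (x i - p i) ^ 2 + R ^ 2

theorem contDiff_quadCutoff (p : E n) (R : ℝ) : ContDiff ℝ 2 (quadCutoff p R) :=
  (ContDiff.sum fun i _ => (contDiff_coord_sub p i).pow 2).neg.add contDiff_const

theorem quadCutoff_eq (p : E n) (R : ℝ) (x : E n) :
    quadCutoff p R x = R ^ 2 - dist x p ^ 2 := by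
  rw [quadCutoff, EuclideanSpace.dist_eq, Real.sq_sqrt (by positivity)]
  simp only [Real.dist_eq, sq_abs]
  ring

theorem pd_quadCutoff (p : E n) (R : ℝ) (k : Fin n) :
    pd k (quadCutoff p R) = fun x => -2 * (x k - p k) := by
  have hd (i : Fin n) : Differentiable ℝ (fun x : E n => x i - p i) :=
    (contDiff_coord_sub p i).differentiable (by norm_num)
  have hs : Differentiable ℝ (fun x : E n => ∑ i, (x i - p i) ^ 2) :=
    Differentiable.fun_sum fun i _ => (hd i).fun_pow 2
  have hc : pd k (fun _ : E n => R ^ 2) = fun _ => 0 := by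
    funext x; simp [pd]
  change pd k (fun x => -∑ i, (x i - p i) ^ 2 + R ^ 2) = _
  rw [pd_add hs.fun_neg (differentiable_const _), pd_neg, pd_sum fun i => (hd i).fun_pow 2, hc]
  simp [pd_sq (hd _), pd_coord_sub]

theorem pd_quadCutoff_sq (p : E n) (R : ℝ) (k : Fin n) :
    pd k (fun x => quadCutoff p R x * quadCutoff p R x) =
      fun x => -4 * quadCutoff p R x * (x k - p k) := by
  have hd := (contDiff_quadCutoff p R).differentiable (by norm_num)
  rw [pd_mul hd hd, pd_quadCutoff]
  funext x
  ring

theorem pd_pd_quadCutoff_sq (p : E n) (R : ℝ) (k : Fin n) :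
    pd k (pd k (fun x => quadCutoff p R x * quadCutoff p R x)) =
      fun x => 8 * (x k - p k) ^ 2 - 4 * quadCutoff p R x := by
  have h2 : pd k (fun x : E n => -2 * (x k - p k)) = fun _ => -2 := by
    have hd : Differentiable ℝ (fun x : E n => x k - p k) :=
      (contDiff_coord_sub p k).differentiable (by norm_num)
    rw [pd_mul (differentiable_const _) hd, pd_coord_sub]
    funext x
    simp [pd]
  rw [pd_pd_mul (contDiff_quadCutoff p R) (contDiff_quadCutoff p R), pd_quadCutoff, h2]
  funext x
  ring

end Cutoff

section GradientEstimate

variable {n : ℕ}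

/-- The algebraic inequality behind the gradient estimate at a maximum point of `ρ² |∇w|²`. -/
theorem cutoff_mul_le_of_max {κ l q H H' a S ρ r R s N c : ℝ} (hκ : 0 < κ)
    (hc : c = 2 * l * (1 - l / κ / 4)) (hc0 : 0 < c) (hq : 0 < q) (hρ : ρ = R ^ 2 - r) (hρ0 : 0 < ρ)
    (hr : 0 ≤ r) (hR : 0 < R) (hN : 0 ≤ N) (hs : s ^ 2 ≤ r * q) (ha : ρ * a = 2 * s)
    (hH : H' ≤ l * H) (hS : a ^ 2 + κ * (-q - H - a) ^ 2 ≤ S)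
    (h : ρ ^ 2 * (2 * S - 4 * a * q - 2 * H' * q) - 32 * r * q + (8 * r - 4 * N * ρ) * q ≤ 0) :
    ρ ^ 2 * q ≤ 2 / c * (24 + 4 * N + (8 - 4 * l) ^ 2 / (2 * c)) * R ^ 2 := by
  have hsq : c / 2 * q ^ 2 + l * q * a ≤ κ * (-q - H - a) ^ 2 - l * H * q := by
    have : κ * (-q - H - a) ^ 2 - l * H * q - (c / 2 * q ^ 2 + l * q * a) =
        κ * (q + a + H - l / κ * q / 2) ^ 2 := by
      rw [hc]; field_simp; ring
    nlinarith [mul_nonneg hκ.le (sq_nonneg (q + a + H - l / κ * q / 2))]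
  have hHq : H' * q ≤ l * H * q := mul_le_mul_of_nonneg_right hH hq.le
  have h1 : c * q ^ 2 + 2 * l * q * a - 4 * a * q ≤ 2 * S - 4 * a * q - 2 * H' * q := by
    nlinarith [sq_nonneg a]
  have h2 : (c * (ρ ^ 2 * q)) * q ≤ ((24 + 4 * N) * R ^ 2 + (8 - 4 * l) * (ρ * s)) * q := by
    have h3 := mul_le_mul_of_nonneg_left h1 (sq_nonneg ρ)
    have h4 : ρ ^ 2 * (c * q ^ 2 + 2 * l * q * a - 4 * a * q) =
        c * (ρ ^ 2 * q) * q + (2 * l - 4) * ρ * q * (2 * s) := by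
      rw [← ha]; ring
    have h5 : (24 * r + 4 * N * ρ) * q ≤ (24 + 4 * N) * R ^ 2 * q := by
      apply mul_le_mul_of_nonneg_right _ hq.le
      nlinarith [mul_nonneg hN hr]
    nlinarith
  have h3 := le_of_mul_le_mul_right h2 hq
  have hsR : s ^ 2 ≤ R ^ 2 * q := hs.trans (mul_le_mul_of_nonneg_right (by linarith) hq.le)
  have h4 : (8 - 4 * l) * (ρ * s) ≤ c / 2 * (ρ ^ 2 * q) + (8 - 4 * l) ^ 2 / (2 * c) * R ^ 2 := by
    have h5 : ρ ^ 2 * s ^ 2 / R ^ 2 ≤ ρ ^ 2 * q := by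
      rw [div_le_iff₀ (by positivity)]
      nlinarith [mul_le_mul_of_nonneg_left hsR (sq_nonneg ρ)]
    have h6 : 0 ≤ c / 2 * (ρ * s / R - (8 - 4 * l) / c * R) ^ 2 := by positivity
    have h7 : c / 2 * (ρ * s / R - (8 - 4 * l) / c * R) ^ 2 =
        c / 2 * (ρ ^ 2 * s ^ 2 / R ^ 2) + (8 - 4 * l) ^ 2 / (2 * c) * R ^ 2
          - (8 - 4 * l) * (ρ * s) := by
      field_simp
      ring
    nlinarith [mul_le_mul_of_nonneg_left h5 hc0.le]
  have h5 : c / 2 * (ρ ^ 2 * q) ≤ (24 + 4 * N + (8 - 4 * l) ^ 2 / (2 * c)) * R ^ 2 := by linarith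
  calc ρ ^ 2 * q = 2 / c * (c / 2 * (ρ ^ 2 * q)) := by field_simp
    _ ≤ 2 / c * ((24 + 4 * N + (8 - 4 * l) ^ 2 / (2 * c)) * R ^ 2) := by gcongr
    _ = _ := by ring

/-- Gradient estimate for `Δw + |∇w|² + H = 0` when `∇H = H' ∇w` with `H' ≤ l H`. -/
theorem grad_sq_mul_le {κ l : ℝ} (hl : 0 < l) (hlκ : l < 4 * κ) (hκn : κ * ((n : ℝ) - 1) ≤ 1)
    {w H H' : E n → ℝ} (hw : ContDiff ℝ 2 w) (hHc : ContDiff ℝ 1 H)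
    (hlap : ∀ x, ∑ k, pd k (pd k w) x = -(∑ i, pd i w x ^ 2 + H x))
    (hH : ∀ x i, pd i H x = H' x * pd i w x) (hH' : ∀ x, H' x ≤ l * H x)
    {c : ℝ} (hc : c = 2 * l * (1 - l / κ / 4)) (p : E n) (hp : 0 < ∑ i, pd i w p ^ 2)
    {R : ℝ} (hR : 0 < R) :
    (∑ i, pd i w p ^ 2) * R ^ 2 ≤ 2 / c * (24 + 4 * n + (8 - 4 * l) ^ 2 / (2 * c)) := by
  have hκ : 0 < κ := by linarith
  have hc0 : 0 < c := by
    have : l / κ < 4 := by rwa [div_lt_iff₀ hκ]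
    rw [hc]
    exact mul_pos (by linarith) (by linarith)
  have hwk (i : Fin n) : ContDiff ℝ 1 (pd i w) := ContDiff.pd (m := 1) hw i
  have hwd (i : Fin n) : Differentiable ℝ (pd i w) := (hwk i).differentiable (by norm_num)
  have hQ : ContDiff ℝ 1 (fun x => ∑ i, pd i w x ^ 2) := ContDiff.sum fun i _ => (hwk i).pow 2
  have hgc : ContDiff ℝ 1 (fun x => -(∑ i, pd i w x ^ 2 + H x)) := (hQ.add hHc).neg
  have hηp : quadCutoff p R p = R ^ 2 := by simp [quadCutoff_eq]
  obtain ⟨x, hx, hmax, hfst, hsnd⟩ := exists_max_mul_sq_grad (p := p) hw hgc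
    ((contDiff_quadCutoff p R).mul (contDiff_quadCutoff p R)) hlap hR
    (fun x hx => by simp [quadCutoff_eq, hx]) (by rw [hηp]; positivity)
  simp only [pd_pd_quadCutoff_sq] at hsnd
  simp only [pd_quadCutoff_sq, hηp] at hmax hfst hsnd
  have hgk (i : Fin n) : pd i (fun x => -(∑ i, pd i w x ^ 2 + H x)) x =
      -(∑ j, 2 * pd j w x * pd i (pd j w) x + H' x * pd i w x) := by
    rw [pd_neg, pd_add (hQ.differentiable (by norm_num)) (hHc.differentiable (by norm_num)),
      pd_sum fun i => (hwd i).fun_pow 2]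
    simp only [pd_sq (hwd _), hH]
  simp only [hgk] at hsnd
  set ρ := quadCutoff p R x with ρ_def
  set q := ∑ i, pd i w x ^ 2 with q_def
  set r := ∑ i, (x i - p i) ^ 2 with r_def
  set s := ∑ i, (x i - p i) * pd i w x with s_def
  have hρ : ρ = R ^ 2 - r := by rw [ρ_def, quadCutoff]; ring
  have hρ0 : 0 < ρ := by
    rw [ρ_def, quadCutoff_eq]
    have : dist x p < R := hx
    nlinarith [dist_nonneg (x := x) (y := p)]
  have hq : 0 < q := by
    have : 0 < ρ * ρ * q := lt_of_lt_of_le (by positivity) hmax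
    exact (mul_pos_iff_of_pos_left (by positivity)).1 this
  have hQk (k : Fin n) : ρ * ∑ i, 2 * pd i w x * pd i (pd k w) x = 4 * (x k - p k) * q := by
    have := hfst k
    apply mul_left_cancel₀ hρ0.ne'
    linarith
  set a := 2 * s / ρ with a_def
  have ha : ρ * a = 2 * s := by rw [a_def]; field_simp
  have hW : ∑ k, ∑ i, pd k w x * pd i w x * pd i (pd k w) x = a * q := by
    have h1 : ρ * (2 * ∑ k, ∑ i, pd k w x * pd i w x * pd i (pd k w) x) = 4 * s * q := by
      calc _ = ∑ k, pd k w x * (ρ * ∑ i, 2 * pd i w x * pd i (pd k w) x) := by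
            simp only [Finset.mul_sum]
            refine Finset.sum_congr rfl fun k _ => Finset.sum_congr rfl fun i _ => ?_
            ring
        _ = _ := by
            simp only [hQk, s_def, Finset.mul_sum, Finset.sum_mul]
            refine Finset.sum_congr rfl fun k _ => ?_
            ring
    apply mul_left_cancel₀ hρ0.ne'
    rw [← mul_assoc, ha]
    linarith
  have hS := sq_add_mul_sq_le_sum_sq (fun k i => pd i (pd k w) x) (fun i => pd i w x)
    q_def.symm hq hW hκ.le hκn
  rw [hlap x, ← q_def] at hS
  have key := cutoff_mul_le_of_max (N := n) (H := H x) (S := ∑ k, ∑ i, pd i (pd k w) x ^ 2)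
    hκ hc hc0 hq hρ hρ0 (by positivity) hR (by positivity)
    (Finset.sum_mul_sq_le_sq_mul_sq Finset.univ (fun i => x i - p i) (fun i => pd i w x))
    ha (hH' x) (by convert hS using 3; ring) ?_
  · have : R ^ 2 * ((∑ i, pd i w p ^ 2) * R ^ 2) ≤
        R ^ 2 * (2 / c * (24 + 4 * n + (8 - 4 * l) ^ 2 / (2 * c))) := by linarith
    exact le_of_mul_le_mul_left this (by positivity)
  · have e1 : ∑ k, ∑ i, 2 * pd i (pd k w) x ^ 2 = 2 * ∑ k, ∑ i, pd i (pd k w) x ^ 2 := by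
      simp only [Finset.mul_sum]
    have e2 : ∑ i, 2 * (pd i w x *
        -(∑ j, 2 * pd j w x * pd i (pd j w) x + H' x * pd i w x)) =
        -4 * (a * q) - 2 * H' x * q := by
      rw [← hW, q_def, Finset.sum_comm, Finset.mul_sum, Finset.mul_sum, ← Finset.sum_sub_distrib]
      refine Finset.sum_congr rfl fun i _ => ?_
      rw [mul_neg, mul_add, mul_neg, mul_add, Finset.mul_sum, Finset.mul_sum, Finset.mul_sum,
        neg_add, ← Finset.sum_neg_distrib, sub_eq_add_neg]
      congr 1
      · refine Finset.sum_congr rfl fun j _ => ?_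
        ring
      · ring
    have e3 : ∑ k, -4 * ρ * (x k - p k) * ∑ i, 2 * pd i w x * pd i (pd k w) x =
        -16 * r * q := by
      rw [mul_assoc, r_def, Finset.sum_mul, Finset.mul_sum]
      refine Finset.sum_congr rfl fun k _ => ?_
      linear_combination (-4 * (x k - p k)) * hQk k
    have e4 : ∑ k, (8 * (x k - p k) ^ 2 - 4 * ρ) = 8 * r - 4 * n * ρ := by
      rw [Finset.sum_sub_distrib, ← Finset.mul_sum]
      simp
      ring
    rw [e1, e2, e3, e4] at hsnd
    linarith

theorem grad_sq_eq_zero {κ l : ℝ} (hl : 0 < l) (hlκ : l < 4 * κ) (hκn : κ * ((n : ℝ) - 1) ≤ 1)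
    {w H H' : E n → ℝ} (hw : ContDiff ℝ 2 w) (hHc : ContDiff ℝ 1 H)
    (hlap : ∀ x, ∑ k, pd k (pd k w) x = -(∑ i, pd i w x ^ 2 + H x))
    (hH : ∀ x i, pd i H x = H' x * pd i w x) (hH' : ∀ x, H' x ≤ l * H x) (p : E n) :
    ∑ i, pd i w p ^ 2 = 0 := by
  by_contra hne
  have hp : 0 < ∑ i, pd i w p ^ 2 := lt_of_le_of_ne (by positivity) (Ne.symm hne)
  obtain ⟨K, hK⟩ : ∃ K : ℝ, ∀ R : ℝ, 0 < R → (∑ i, pd i w p ^ 2) * R ^ 2 ≤ K :=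
    ⟨_, fun R hR => grad_sq_mul_le hl hlκ hκn hw hHc hlap hH hH' rfl p hp hR⟩
  have hlim : Tendsto (fun R : ℝ => (∑ i, pd i w p ^ 2) * R ^ 2) atTop atTop :=
    (tendsto_pow_atTop two_ne_zero).const_mul_atTop hp
  obtain ⟨R, hR, hKR⟩ := ((eventually_gt_atTop 0).and (hlim.eventually_gt_atTop K)).exists
  exact absurd (hK R hR) (not_le.2 hKR)

end GradientEstimate

theorem mul_deriv_le_of_rpow_neg_mul_antitone {α : ℝ} {f : ℝ → ℝ}
    (hf : ContDiffOn ℝ 2 f (Ioi 0))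
    (hmono : ∀ s t : ℝ, 0 < s → s ≤ t → t ^ (-α) * f t ≤ s ^ (-α) * f s) {t : ℝ} (ht : 0 < t) :
    t * deriv f t ≤ α * f t := by
  have hfd : HasDerivAt f (deriv f t) t :=
    ((hf.contDiffAt (Ioi_mem_nhds ht)).differentiableAt (by norm_num)).hasDerivAt
  have hd := (Real.hasDerivAt_rpow_const (p := -α) (Or.inl ht.ne')).mul hfd
  have hanti : AntitoneOn ((fun s : ℝ => s ^ (-α)) * f) (Ioi 0) :=
    fun s hs t _ hst => hmono s t hs hst
  have hnon := hanti.derivWithin_nonpos (x := t)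
  rw [derivWithin_of_isOpen isOpen_Ioi ht, hd.deriv, Real.rpow_sub_one ht.ne'] at hnon
  have hpos : 0 < t ^ (-α) := Real.rpow_pos_of_pos ht _
  have : t ^ (-α) / t * (t * deriv f t - α * f t) ≤ 0 := by
    refine le_of_eq_of_le ?_ hnon
    field_simp
    ring
  nlinarith [nonpos_of_mul_nonpos_right this (by positivity)]

/-- Liouville theorem: every positive global solution of `Δu + f(u) = 0` on ℝⁿ
is constant, when `t ↦ t^{-α} f(t)` is non-increasing on `(0,∞)` for some `α ∈ (1, p(n))`. -/
theorem stmt3 (n : ℕ) (hn : 0 < n) (α : ℝ) (hα : 1 < α)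
    (hαp : 1 < n → α < ((n : ℝ) + 3) / ((n : ℝ) - 1))
    (f : ℝ → ℝ) (hf : ContDiffOn ℝ 2 f (Ioi 0))
    (hmono : ∀ s t : ℝ, 0 < s → s ≤ t → t ^ (-α) * f t ≤ s ^ (-α) * f s)
    (u : E n → ℝ) (hu : ContDiff ℝ 2 u) (hupos : ∀ x, 0 < u x)
    (heq : ∀ x, lap u x + f (u x) = 0) :
    ∀ x y : E n, u x = u y := by
  have hud : Differentiable ℝ u := hu.differentiable (by norm_num)
  have hu0 (x : E n) : u x ≠ 0 := (hupos x).ne'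
  have hfu : ContDiff ℝ 2 (fun x => f (u x)) := contDiff_iff_contDiffAt.2 fun x =>
    (hf.contDiffAt (Ioi_mem_nhds (hupos x))).comp x hu.contDiffAt
  have hH : ContDiff ℝ 2 (fun x => f (u x) / u x) := hfu.div hu hu0
  have hHd : Differentiable ℝ (fun x => f (u x) / u x) := hH.differentiable (by norm_num)
  have hw : ContDiff ℝ 2 (fun x => Real.log (u x)) := hu.log hu0
  have hwi (i : Fin n) (x : E n) : u x * pd i (fun x => Real.log (u x)) x = pd i u x := by
    have := pd_comp (φ := Real.log) (Real.differentiableAt_log (hu0 x)) (hud x) i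
    rw [this, Real.deriv_log, mul_inv_cancel_left₀ (hu0 x)]
  have hlap (x : E n) : ∑ k, pd k (pd k fun x => Real.log (u x)) x =
      -(∑ i, pd i (fun x => Real.log (u x)) x ^ 2 + f (u x) / u x) := by
    have hwk (k : Fin n) : Differentiable ℝ (pd k fun x => Real.log (u x)) :=
      (ContDiff.pd (m := 1) hw k).differentiable (by norm_num)
    have h1 (k : Fin n) : pd k (pd k u) x = u x * pd k (pd k fun x => Real.log (u x)) x +
        u x * pd k (fun x => Real.log (u x)) x ^ 2 := by
      conv_lhs => rw [← funext (hwi k), pd_mul hud (hwk k)]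
      simp only [← hwi k x]
      ring
    have h2 := heq x
    rw [lap_eq_sum_pd hu] at h2
    simp only [h1, Finset.sum_add_distrib, ← Finset.mul_sum] at h2
    have := hu0 x
    field_simp
    linarith
  have hHi (x : E n) (i : Fin n) : pd i (fun x => f (u x) / u x) x =
      (deriv f (u x) - f (u x) / u x) * pd i (fun x => Real.log (u x)) x := by
    have hfd : DifferentiableAt ℝ f (u x) :=
      (hf.contDiffAt (Ioi_mem_nhds (hupos x))).differentiableAt (by norm_num)
    have h1 : pd i (fun x => u x * (f (u x) / u x)) x = deriv f (u x) * pd i u x := by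
      rw [← pd_comp hfd (hud x)]
      congr 2
      funext y
      exact mul_div_cancel₀ _ (hu0 y)
    simp only [pd_mul hud hHd, ← hwi i x] at h1
    apply mul_left_cancel₀ (hu0 x)
    linear_combination h1
  have hH' (x : E n) : deriv f (u x) - f (u x) / u x ≤ (α - 1) * (f (u x) / u x) := by
    have := mul_deriv_le_of_rpow_neg_mul_antitone hf hmono (hupos x)
    have h1 : deriv f (u x) ≤ α * f (u x) / u x := by
      rw [le_div_iff₀ (hupos x)]
      linarith
    rw [mul_div_assoc] at h1
    linarith
  obtain ⟨κ, hακ, hκn⟩ : ∃ κ : ℝ, α - 1 < 4 * κ ∧ κ * ((n : ℝ) - 1) ≤ 1 := by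
    rcases Nat.lt_or_ge 1 n with h | h
    · have hn1 : (0 : ℝ) < n - 1 := by
        have : (1 : ℝ) < n := by exact_mod_cast h
        linarith
      refine ⟨1 / ((n : ℝ) - 1), ?_, by rw [one_div_mul_cancel hn1.ne']⟩
      have := hαp h
      have e : ((n : ℝ) + 3) / (n - 1) = 1 + 4 * (1 / (n - 1)) := by field_simp; ring
      linarith
    · obtain rfl : n = 1 := by omega
      exact ⟨α, by linarith, by norm_num⟩
  have hgrad (x : E n) (i : Fin n) : pd i u x = 0 := by
    have h := grad_sq_eq_zero (by linarith) hακ hκn hw (hH.of_le (by norm_num)) hlap hHi hH' x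
    rw [Finset.sum_eq_zero_iff_of_nonneg fun _ _ => sq_nonneg _] at h
    rw [← hwi i x, pow_eq_zero_iff two_ne_zero |>.1 (h i (Finset.mem_univ i)), mul_zero]
  refine is_const_of_fderiv_eq_zero hud fun x => ?_
  have : (fderiv ℝ u x : E n →ₗ[ℝ] ℝ) = 0 :=
    (EuclideanSpace.basisFun (Fin n) ℝ).toBasis.ext fun i => by simpa [pd] using hgrad x i
  exact ContinuousLinearMap.coe_injective this
end

section
/- Let n be a positive integer and let α ∈ (1, p_S(n)). Then there is no positive solution of the Lane–Emden equation Δu + u^α = 0 on all of ℝⁿ. -/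
open Set Metric

open Filter Topology

/-- `f` is twice differentiable at `y` along every coordinate line, and the sum of the second
derivatives along these lines is `L`. -/
def HasLapAt {n : ℕ} (f : E n → ℝ) (L : ℝ) (y : E n) : Prop :=
  ∃ (f' : Fin n → ℝ → ℝ) (b : Fin n → ℝ),
    (∀ i, ∀ᶠ s in 𝓝 (0 : ℝ),
      HasDerivAt (fun s : ℝ => f (y + s • EuclideanSpace.single i (1 : ℝ))) (f' i s) s) ∧
    (∀ i, HasDerivAt (f' i) (b i) 0) ∧ ∑ i, b i = L

namespace HasLapAt

variable {n : ℕ} {f g : E n → ℝ} {L M : ℝ} {y : E n}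

lemma add (hf : HasLapAt f L y) (hg : HasLapAt g M y) :
    HasLapAt (fun z => f z + g z) (L + M) y := by
  obtain ⟨f', b, h1, h2, rfl⟩ := hf
  obtain ⟨g', c, k1, k2, rfl⟩ := hg
  refine ⟨fun i s => f' i s + g' i s, fun i => b i + c i, fun i => ?_, fun i => ?_, ?_⟩
  · filter_upwards [h1 i, k1 i] with s hs ks using hs.add ks
  · exact (h2 i).add (k2 i)
  · exact Finset.sum_add_distrib

lemma const_mul (c : ℝ) (hf : HasLapAt f L y) : HasLapAt (fun z => c * f z) (c * L) y := by
  obtain ⟨f', b, h1, h2, rfl⟩ := hf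
  refine ⟨fun i s => c * f' i s, fun i => c * b i, fun i => ?_, fun i => ?_, ?_⟩
  · filter_upwards [h1 i] with s hs using hs.const_mul c
  · exact (h2 i).const_mul c
  · exact (Finset.mul_sum ..).symm

lemma const (c : ℝ) : HasLapAt (fun _ : E n => c) 0 y :=
  ⟨fun _ _ => 0, fun _ => 0, fun _ => .of_forall fun s => hasDerivAt_const s c,
    fun _ => hasDerivAt_const 0 0, by simp⟩

end HasLapAt

/-- The second derivative is nonnegative at a local minimum. -/
lemma second_deriv_nonneg_of_isLocalMin {φ φ' : ℝ → ℝ} {b : ℝ}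
    (h : ∀ᶠ s in 𝓝 (0 : ℝ), HasDerivAt φ (φ' s) s) (h' : HasDerivAt φ' b 0)
    (hmin : IsLocalMin φ 0) : 0 ≤ b := by
  by_contra! hb
  have hd : deriv φ =ᶠ[𝓝 0] φ' := h.mono fun s hs => hs.deriv
  have hdd : deriv (deriv φ) 0 = b := hd.deriv_eq.trans h'.deriv
  have hmax : IsLocalMax φ 0 :=
    isLocalMax_of_deriv_deriv_neg (by rwa [hdd]) hmin.deriv_eq_zero h.self_of_nhds.continuousAt
  have hconst : φ =ᶠ[𝓝 0] fun _ => φ 0 := by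
    filter_upwards [hmin, hmax] with s h1 h2 using le_antisymm h2 h1
  have hzero : deriv φ =ᶠ[𝓝 0] fun _ => 0 := by
    have := hconst.deriv
    simpa using this
  have : deriv (deriv φ) 0 = 0 := by rw [hzero.deriv_eq]; simp
  linarith

lemma HasLapAt.nonneg_of_isLocalMin {n : ℕ} {f : E n → ℝ} {L : ℝ} {y : E n}
    (hf : HasLapAt f L y) (hmin : IsLocalMin f y) : 0 ≤ L := by
  obtain ⟨f', b, h1, h2, rfl⟩ := hf
  refine Finset.sum_nonneg fun i _ => second_deriv_nonneg_of_isLocalMin (h1 i) (h2 i) ?_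
  have hc : Tendsto (fun s : ℝ => y + s • EuclideanSpace.single i (1 : ℝ)) (𝓝 0) (𝓝 y) := by
    have : Continuous fun s : ℝ => y + s • EuclideanSpace.single i (1 : ℝ) := by fun_prop
    simpa using this.tendsto 0
  simpa [IsLocalMin, IsMinFilter] using hc.eventually hmin

lemma hasDerivAt_of_eq {F : Type*} [NormedAddCommGroup F] [NormedSpace ℝ F] {f g : ℝ → F}
    {f' g' : F} {s : ℝ} (h : HasDerivAt f f' s) (hfg : ∀ t, g t = f t) (hderiv : g' = f') :
    HasDerivAt g g' s := by
  rw [funext hfg, hderiv]; exact h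

/-- The lines through `y` in the `i`-th coordinate direction have constant velocity. -/
lemma hasDerivAt_line {n : ℕ} (y : E n) (i : Fin n) (s : ℝ) :
    HasDerivAt (fun s : ℝ => y + s • EuclideanSpace.single i (1 : ℝ))
      (EuclideanSpace.single i (1 : ℝ)) s := by
  simpa using ((hasDerivAt_id s).smul_const (EuclideanSpace.single i (1 : ℝ))).const_add y

lemma lap_eq_sum_fderiv {n : ℕ} (u : E n → ℝ) (y : E n) :
    lap u y = ∑ i, fderiv ℝ (fderiv ℝ u) y (EuclideanSpace.single i (1 : ℝ))
      (EuclideanSpace.single i (1 : ℝ)) := by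
  simp [lap, iteratedFDeriv_two_apply]

lemma hasLapAt_lap {n : ℕ} {u : E n → ℝ} (hu : ContDiff ℝ 2 u) (y : E n) :
    HasLapAt u (lap u y) y := by
  refine ⟨fun i s => fderiv ℝ u (y + s • EuclideanSpace.single i (1 : ℝ))
      (EuclideanSpace.single i (1 : ℝ)), _, fun i => .of_forall fun s => ?_, fun i => ?_,
      (lap_eq_sum_fderiv u y).symm⟩
  · exact ((hu.differentiable (by norm_num)) _).hasFDerivAt.comp_hasDerivAt s
      (hasDerivAt_line y i s)
  · have h1 : Differentiable ℝ (fderiv ℝ u) :=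
      (hu.fderiv_right (m := 1) (by norm_num)).differentiable (by norm_num)
    have h2 := (h1 (y + (0 : ℝ) • EuclideanSpace.single i (1 : ℝ))).hasFDerivAt.comp_hasDerivAt 0
      (hasDerivAt_line y i 0)
    simpa using h2.clm_apply (hasDerivAt_const (0 : ℝ) (EuclideanSpace.single i (1 : ℝ)))

lemma eventually_line_ne_zero {n : ℕ} {y : E n} (hy : y ≠ 0) (i : Fin n) :
    ∀ᶠ s in 𝓝 (0 : ℝ), y + s • EuclideanSpace.single i (1 : ℝ) ≠ 0 := by
  have hc : Continuous fun s : ℝ => y + s • EuclideanSpace.single i (1 : ℝ) := by fun_prop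
  exact hc.continuousAt.eventually_ne (by simpa using hy)

lemma hasDerivAt_norm_sq_line {n : ℕ} (y : E n) (i : Fin n) (s : ℝ) :
    HasDerivAt (fun s : ℝ => ‖y + s • EuclideanSpace.single i (1 : ℝ)‖ ^ 2)
      (2 * (y i + s)) s := by
  have := (hasDerivAt_line y i s).norm_sq
  refine hasDerivAt_of_eq this (fun t => rfl) ?_
  simp [EuclideanSpace.inner_single_right]

lemma hasDerivAt_inv_norm_line {n : ℕ} {y : E n} {i : Fin n} {s : ℝ}
    (h : y + s • EuclideanSpace.single i (1 : ℝ) ≠ 0) :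
    HasDerivAt (fun s : ℝ => ‖y + s • EuclideanSpace.single i (1 : ℝ)‖⁻¹)
      (-((y i + s) * ‖y + s • EuclideanSpace.single i (1 : ℝ)‖⁻¹ ^ 3)) s := by
  have h0 := norm_ne_zero_iff.2 h
  have h1 := ((hasDerivAt_norm_sq_line y i s).sqrt (by positivity)).inv (by positivity)
  simp only [Real.sqrt_sq (norm_nonneg _)] at h1
  refine hasDerivAt_of_eq h1 (fun t => rfl) ?_
  field_simp

lemma hasDerivAt_inv_norm_line_pow {n : ℕ} {y : E n} {i : Fin n} {s : ℝ}
    (h : y + s • EuclideanSpace.single i (1 : ℝ) ≠ 0) (k : ℕ) :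
    HasDerivAt (fun s : ℝ => ‖y + s • EuclideanSpace.single i (1 : ℝ)‖⁻¹ ^ k)
      (-(k * (y i + s) * ‖y + s • EuclideanSpace.single i (1 : ℝ)‖⁻¹ ^ (k + 2))) s := by
  refine hasDerivAt_of_eq ((hasDerivAt_inv_norm_line h).pow k) (fun t => rfl) ?_
  cases k with
  | zero => simp
  | succ k => push_cast [Nat.add_sub_cancel]; ring

/-- For `n ≤ 2` the function `log ‖y‖` is superharmonic away from the origin. -/
lemma hasLapAt_log_norm {n : ℕ} {y : E n} (hy : y ≠ 0) :
    HasLapAt (fun z => Real.log ‖z‖) ((n - 2) * ‖y‖⁻¹ ^ 2) y := by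
  refine ⟨fun i s => (y i + s) * ‖y + s • EuclideanSpace.single i (1 : ℝ)‖⁻¹ ^ 2,
    fun i => ‖y‖⁻¹ ^ 2 - 2 * y i ^ 2 * ‖y‖⁻¹ ^ 4, fun i => ?_, fun i => ?_, ?_⟩
  · filter_upwards [eventually_line_ne_zero hy i] with s hs
    have h0 := norm_ne_zero_iff.2 hs
    have h1 := ((hasDerivAt_norm_sq_line y i s).log (by positivity)).div_const 2
    refine hasDerivAt_of_eq h1 (fun t => ?_) ?_
    · simp [Real.log_pow]
    · field_simp
  · have h0 : y + (0 : ℝ) • EuclideanSpace.single i (1 : ℝ) ≠ 0 := by simpa using hy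
    have h1 := ((hasDerivAt_id (0 : ℝ)).const_add (y i)).mul (hasDerivAt_inv_norm_line_pow h0 2)
    refine hasDerivAt_of_eq h1 (fun t => rfl) ?_
    simp
    ring
  · have h0 := norm_ne_zero_iff.2 hy
    rw [Finset.sum_sub_distrib, ← Finset.sum_mul, ← Finset.mul_sum,
      ← EuclideanSpace.real_norm_sq_eq]
    simp
    field_simp

/-- The Kelvin transform of `v` with respect to the sphere of radius `lam` centred at `0`. -/
noncomputable def kelvin {m : ℕ} (v : E (m + 2) → ℝ) (lam : ℝ) (y : E (m + 2)) : ℝ :=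
  (lam / ‖y‖) ^ m * v ((lam / ‖y‖) ^ 2 • y)

lemma hasLapAt_kelvin {m : ℕ} {v : E (m + 2) → ℝ} (hv : ContDiff ℝ 2 v) (lam : ℝ)
    {y : E (m + 2)} (hy : y ≠ 0) :
    HasLapAt (kelvin v lam) ((lam / ‖y‖) ^ (m + 4) * lap v ((lam / ‖y‖) ^ 2 • y)) y := by
  set e : Fin (m + 2) → E (m + 2) := fun i => EuclideanSpace.single i (1 : ℝ) with he
  set p : Fin (m + 2) → ℝ → ℝ := fun i s => ‖y + s • e i‖⁻¹ with hp
  set γ : Fin (m + 2) → ℝ → E (m + 2) := fun i s => (lam ^ 2 * p i s ^ 2) • (y + s • e i) with hγ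
  set D := fderiv ℝ v with hD
  have hdv : Differentiable ℝ v := hv.differentiable (by norm_num)
  have hdD : Differentiable ℝ D :=
    (hv.fderiv_right (m := 1) (by norm_num)).differentiable (by norm_num)
  have hpow (i s) (h : y + s • e i ≠ 0) (k : ℕ) :
      HasDerivAt (fun s => p i s ^ k) (-(k * (y i + s) * p i s ^ (k + 2))) s :=
    hasDerivAt_inv_norm_line_pow h k
  have hdγ (i s) (h : y + s • e i ≠ 0) : HasDerivAt (γ i)
      ((lam ^ 2 * p i s ^ 2) • e i -
        (2 * lam ^ 2 * (y i + s) * p i s ^ 4) • (y + s • e i)) s := by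
    refine hasDerivAt_of_eq (((hpow i s h 2).const_mul (lam ^ 2)).smul (hasDerivAt_line y i s))
      (fun t => rfl) ?_
    rw [sub_eq_add_neg, ← neg_smul]
    congr 2
    push_cast; ring
  set p0 := ‖y‖⁻¹ with hp0
  set z := (lam ^ 2 * p0 ^ 2) • y with hz
  have hγ0 (i) : γ i 0 = z := by simp [hγ, hp, hz, hp0]
  have hpi0 (i) : p i 0 = p0 := by simp [hp, hp0]
  set H := fderiv ℝ D z with hH
  have hdD0 (i) : HasDerivAt (fun s => D (γ i s))
      (H ((lam ^ 2 * p0 ^ 2) • e i - (2 * lam ^ 2 * y i * p0 ^ 4) • y)) 0 := by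
    have h1 := (hdD (γ i 0)).hasFDerivAt.comp_hasDerivAt (0 : ℝ) (hdγ i 0 (by simpa using hy))
    refine hasDerivAt_of_eq h1 (fun t => rfl) ?_
    simp [hγ0, hpi0, hH]
  refine ⟨fun i s => lam ^ m * (-(m * ((y i + s) * (p i s ^ (m + 2) * v (γ i s)))) + lam ^ 2 *
      (p i s ^ (m + 2) * D (γ i s) (e i) -
        2 * ((y i + s) * (p i s ^ (m + 4) * D (γ i s) (y + s • e i))))),
    fun i => lam ^ m * (-(m * p0 ^ (m + 2) * v z) + m * (m + 2) * y i ^ 2 * p0 ^ (m + 4) * v z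
      - m * y i * p0 ^ (m + 2) * lam ^ 2 * (p0 ^ 2 * D z (e i) - 2 * y i * p0 ^ 4 * D z y)
      + lam ^ 2 * (-((m + 2) * y i * p0 ^ (m + 4) * D z (e i))
        + p0 ^ (m + 2) * lam ^ 2 * (p0 ^ 2 * H (e i) (e i) - 2 * y i * p0 ^ 4 * H y (e i))
        - 2 * p0 ^ (m + 4) * D z y + 2 * (m + 4) * y i ^ 2 * p0 ^ (m + 6) * D z y
        - 2 * y i * p0 ^ (m + 4) * (lam ^ 2 *
            (p0 ^ 2 * H (e i) y - 2 * y i * p0 ^ 4 * H y y) + D z (e i)))),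
    fun i => ?_, fun i => ?_, ?_⟩
  · filter_upwards [eventually_line_ne_zero hy i] with s hs
    have h1 := ((hpow i s hs m).mul
      ((hdv (γ i s)).hasFDerivAt.comp_hasDerivAt s (hdγ i s hs))).const_mul (lam ^ m)
    refine hasDerivAt_of_eq h1 (fun t => ?_) ?_
    · simp only [kelvin, hγ, hp, he, div_eq_mul_inv, mul_pow, Pi.mul_apply, Function.comp_apply]
      ring
    · simp only [map_sub, map_smul, smul_eq_mul, hD, Function.comp_apply]
      ring
  · have h0 : y + (0 : ℝ) • e i ≠ 0 := by simpa using hy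
    have ht := (hasDerivAt_id (0 : ℝ)).const_add (y i)
    have h1 := ((hdv (γ i 0)).hasFDerivAt.comp_hasDerivAt 0 (hdγ i 0 h0))
    have h2 := (hdD0 i).clm_apply (hasDerivAt_const (0 : ℝ) (e i))
    have h3 := (hdD0 i).clm_apply (hasDerivAt_line y i 0)
    have h4 := (((ht.mul ((hpow i 0 h0 (m + 2)).mul h1)).const_mul (m : ℝ)).neg.add
      ((((hpow i 0 h0 (m + 2)).mul h2).sub
        ((ht.mul ((hpow i 0 h0 (m + 4)).mul h3)).const_mul 2)).const_mul
          (lam ^ 2))).const_mul (lam ^ m)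
    refine hasDerivAt_of_eq h4 (fun t => rfl) ?_
    simp only [map_sub, map_smul, smul_eq_mul, hγ0, hpi0, ← hD, id, Function.comp_apply, zero_smul,
      add_zero, sub_apply, smul_apply, Pi.mul_apply,
      map_zero]
    push_cast
    ring
  · have hN := norm_ne_zero_iff.2 hy
    have hy2 : ∑ i, y i ^ 2 = ‖y‖ ^ 2 := (EuclideanSpace.real_norm_sq_eq y).symm
    have hye : ∑ i, y i • e i = y := by
      ext j; simp [he, Finset.sum_apply, Pi.single_apply]
    have hsum (l : E (m + 2) →L[ℝ] ℝ) : ∑ i, y i * l (e i) = l y := by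
      conv_rhs => rw [← hye]
      simp
    have hlap : lap v ((lam / ‖y‖) ^ 2 • y) = ∑ i, H (e i) (e i) := by
      rw [lap_eq_sum_fderiv, div_eq_mul_inv, mul_pow]
    have hpN : p0 ^ 2 * ‖y‖ ^ 2 = 1 := by rw [hp0]; field_simp
    have hsplit (i) : lam ^ m * (-(m * p0 ^ (m + 2) * v z)
        + m * (m + 2) * y i ^ 2 * p0 ^ (m + 4) * v z
        - m * y i * p0 ^ (m + 2) * lam ^ 2 * (p0 ^ 2 * D z (e i) - 2 * y i * p0 ^ 4 * D z y)
        + lam ^ 2 * (-((m + 2) * y i * p0 ^ (m + 4) * D z (e i))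
          + p0 ^ (m + 2) * lam ^ 2 * (p0 ^ 2 * H (e i) (e i) - 2 * y i * p0 ^ 4 * H y (e i))
          - 2 * p0 ^ (m + 4) * D z y + 2 * (m + 4) * y i ^ 2 * p0 ^ (m + 6) * D z y
          - 2 * y i * p0 ^ (m + 4) * (lam ^ 2 *
              (p0 ^ 2 * H (e i) y - 2 * y i * p0 ^ 4 * H y y) + D z (e i)))) =
        lam ^ m * (-(m * p0 ^ (m + 2) * v z) - 2 * lam ^ 2 * p0 ^ (m + 4) * D z y)
        + lam ^ m * (m * (m + 2) * p0 ^ (m + 4) * v z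
          + (4 * m + 8) * lam ^ 2 * p0 ^ (m + 6) * D z y
          + 4 * lam ^ 4 * p0 ^ (m + 8) * H y y) * y i ^ 2
        - lam ^ m * ((2 * m + 4) * lam ^ 2 * p0 ^ (m + 4)) * (y i * D z (e i))
        + lam ^ m * (lam ^ 4 * p0 ^ (m + 4)) * H (e i) (e i)
        - lam ^ m * (2 * lam ^ 4 * p0 ^ (m + 6)) * (y i * H y (e i))
        - lam ^ m * (2 * lam ^ 4 * p0 ^ (m + 6)) * (y i * H.flip y (e i)) := by
      rw [ContinuousLinearMap.flip_apply]
      ring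
    rw [hlap]
    simp only [hsplit, Finset.sum_add_distrib, Finset.sum_sub_distrib, ← Finset.mul_sum, hsum, hy2,
      div_eq_mul_inv, ← hp0, Finset.sum_const,
      Finset.card_univ, Fintype.card_fin, nsmul_eq_mul]
    rw [ContinuousLinearMap.flip_apply]
    push_cast
    linear_combination lam ^ m * (m * (m + 2) * p0 ^ (m + 2) * v z
      + (4 * m + 8) * lam ^ 2 * p0 ^ (m + 4) * D z y + 4 * lam ^ 4 * p0 ^ (m + 6) * H y y) * hpN

lemma HasLapAt.sub {n : ℕ} {f g : E n → ℝ} {L M : ℝ} {y : E n} (hf : HasLapAt f L y)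
    (hg : HasLapAt g M y) : HasLapAt (fun z => f z - g z) (L - M) y := by
  simpa [sub_eq_add_neg] using hf.add (hg.const_mul (-1))

/-- A power of the norm with exponent `2 - dim` is harmonic away from the origin. -/
lemma hasLapAt_div_norm_pow {m : ℕ} (lam : ℝ) {y : E (m + 2)} (hy : y ≠ 0) :
    HasLapAt (fun z => (lam / ‖z‖) ^ m) 0 y := by
  have h := hasLapAt_kelvin (contDiff_const (c := (1 : ℝ))) lam hy
  have h0 (x : E (m + 2)) : lap (fun _ => (1 : ℝ)) x = 0 := by
    simp [lap_eq_sum_fderiv, fderiv_fun_const]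
  have h1 : (fun z : E (m + 2) => (lam / ‖z‖) ^ m) = kelvin (fun _ => (1 : ℝ)) lam := by
    ext z; simp [kelvin]
  rw [h1]
  simpa [h0] using h

/-- The weak minimum principle in an annulus for strictly superharmonic functions. -/
lemma nonneg_of_annulus {n : ℕ} {f : E n → ℝ} {a b : ℝ}
    (hc : ContinuousOn f {y | a ≤ ‖y‖ ∧ ‖y‖ ≤ b})
    (hL : ∀ y, a < ‖y‖ → ‖y‖ < b → ∃ L < 0, HasLapAt f L y)
    (ha : ∀ y, ‖y‖ = a → 0 ≤ f y) (hb : ∀ y, ‖y‖ = b → 0 ≤ f y)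
    {y : E n} (hay : a ≤ ‖y‖) (hyb : ‖y‖ ≤ b) : 0 ≤ f y := by
  have hK : IsCompact {y : E n | a ≤ ‖y‖ ∧ ‖y‖ ≤ b} := by
    refine (isCompact_closedBall (0 : E n) b).of_isClosed_subset ?_ fun z hz => by simpa using hz.2
    exact (isClosed_le continuous_const continuous_norm).inter
      (isClosed_le continuous_norm continuous_const)
  obtain ⟨z, ⟨haz, hzb⟩, hz⟩ := hK.exists_isMinOn ⟨y, hay, hyb⟩ hc
  refine le_trans ?_ (hz ⟨hay, hyb⟩)
  rcases haz.eq_or_lt with h | h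
  · exact ha z h.symm
  rcases hzb.eq_or_lt with h' | h'
  · exact hb z h'
  obtain ⟨L, hL0, hLz⟩ := hL z h h'
  have hopen : {y : E n | a ≤ ‖y‖ ∧ ‖y‖ ≤ b} ∈ 𝓝 z := by
    filter_upwards [continuous_norm.continuousAt.eventually_const_lt h,
      continuous_norm.continuousAt.eventually_lt_const h'] with x h1 h2 using ⟨h1.le, h2.le⟩
  exact absurd (hLz.nonneg_of_isLocalMin (hz.isLocalMin hopen)) (not_le.2 hL0)

/-- A nonnegative strictly superharmonic function in an exterior domain, positive on the boundary,
decays at most like the fundamental solution. -/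
lemma exists_decay_lower_bound {m : ℕ} (hm : 0 < m) {f : E (m + 2) → ℝ} {a : ℝ} (ha : 0 < a)
    (hc : ContinuousOn f {y | a ≤ ‖y‖})
    (hL : ∀ y, a < ‖y‖ → ∃ L < 0, HasLapAt f L y) (h0 : ∀ y, a ≤ ‖y‖ → 0 ≤ f y)
    (hpos : ∀ y, ‖y‖ = a → 0 < f y) :
    ∃ c > 0, ∀ y, a ≤ ‖y‖ → c * (1 / ‖y‖) ^ m ≤ f y := by
  obtain ⟨z, hz, hmin⟩ := (isCompact_sphere (0 : E (m + 2)) a).exists_isMinOn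
    (NormedSpace.sphere_nonempty.2 ha.le) (hc.mono fun y hy => by simp_all)
  have hz' : ‖z‖ = a := by simpa using hz
  have hc0 : 0 < f z * a ^ m := mul_pos (hpos z hz') (by positivity)
  refine ⟨f z * a ^ m, hc0, fun y hy => ?_⟩
  refine le_of_forall_pos_le_add fun δ hδ => ?_
  have hlim : Tendsto (fun R : ℝ => f z * a ^ m * (1 / R) ^ m) atTop (𝓝 0) := by
    have h1 : Tendsto (fun R : ℝ => (1 / R) ^ m) atTop (𝓝 0) := by
      simpa [hm.ne'] using (tendsto_inv_atTop_zero (𝕜 := ℝ)).pow m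
    simpa using h1.const_mul (f z * a ^ m)
  obtain ⟨R, hRδ, hRy⟩ :=
    ((hlim.eventually_lt_const hδ).and (eventually_ge_atTop ‖y‖)).exists
  have key := nonneg_of_annulus (n := m + 2) (a := a) (b := R)
    (f := fun x => (f x - f z * a ^ m * (1 / ‖x‖) ^ m) + δ) ?_ ?_ ?_ ?_ hy hRy
  · linarith
  · refine ((hc.mono fun x hx => hx.1).sub (continuousOn_const.mul ?_)).add continuousOn_const
    exact (continuousOn_const.div continuous_norm.continuousOn
      fun x hx => (ha.trans_le hx.1).ne').pow m
  · intro x hx _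
    obtain ⟨L, hL0, hLx⟩ := hL x hx
    have hx0 : x ≠ 0 := norm_pos_iff.1 (ha.trans hx)
    exact ⟨_, by simpa using hL0,
      (hLx.sub ((hasLapAt_div_norm_pow 1 hx0).const_mul _)).add (HasLapAt.const δ)⟩
  · intro x hx
    have h1 : f z ≤ f x := hmin (by simpa using hx)
    have h2 : f z * a ^ m * (1 / ‖x‖) ^ m = f z := by
      rw [hx, mul_assoc, ← mul_pow, mul_one_div_cancel ha.ne', one_pow, mul_one]
    rw [h2]; linarith
  · intro x hx
    have := h0 x (hx ▸ hy.trans hRy)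
    rw [hx]; linarith

/-- `u` is a positive classical solution of the Lane–Emden equation on the whole space. -/
structure IsLaneEmden {n : ℕ} (α : ℝ) (u : E n → ℝ) : Prop where
  contDiff : ContDiff ℝ 2 u
  pos : ∀ x, 0 < u x
  eq : ∀ x, lap u x + u x ^ α = 0

namespace IsLaneEmden

lemma translate {n : ℕ} {α : ℝ} {u : E n → ℝ} (hu : IsLaneEmden α u) (a : E n) :
    IsLaneEmden α fun x => u (a + x) where
  contDiff := hu.contDiff.comp (contDiff_const.add contDiff_id)
  pos x := hu.pos _
  eq x := by simpa [lap, iteratedFDeriv_comp_add_left] using hu.eq (a + x)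

lemma lap_neg {n : ℕ} {α : ℝ} {u : E n → ℝ} (hu : IsLaneEmden α u) (x : E n) : lap u x < 0 := by
  have := hu.eq x
  have := Real.rpow_pos_of_pos (hu.pos x) α
  linarith

variable {m : ℕ} {α : ℝ} {u : E (m + 2) → ℝ} {lam : ℝ}

lemma continuousOn_kelvin (hu : IsLaneEmden α u) (lam : ℝ) :
    ContinuousOn (kelvin u lam) {y | y ≠ 0} := by
  have h : ContinuousOn (fun y : E (m + 2) => lam / ‖y‖) {y | y ≠ 0} :=
    continuousOn_const.div continuous_norm.continuousOn fun y hy => norm_ne_zero_iff.2 hy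
  exact (h.pow m).mul (hu.contDiff.continuous.comp_continuousOn ((h.pow 2).smul continuousOn_id))

/-- In the subcritical range the difference between a solution and its Kelvin transform is
strictly superharmonic outside the sphere wherever it is nonnegative. -/
lemma hasLapAt_sub_kelvin_neg (hu : IsLaneEmden α u) (hα : 1 < α) (hαm : m * α < m + 4)
    (hlam : 0 ≤ lam) {y : E (m + 2)} (hy : lam < ‖y‖) (hle : kelvin u lam y ≤ u y) :
    ∃ L < 0, HasLapAt (fun z => u z - kelvin u lam z) L y := by
  have hy0 : 0 < ‖y‖ := hlam.trans_lt hy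
  refine ⟨_, ?_, (hasLapAt_lap hu.contDiff y).sub
    (hasLapAt_kelvin hu.contDiff lam (norm_pos_iff.1 hy0))⟩
  set q := lam / ‖y‖ with hq
  set z := q ^ 2 • y with hz
  have h1 := hu.eq y
  have h2 := hu.eq z
  rw [show lap u y = -u y ^ α by linarith, show lap u z = -u z ^ α by linarith]
  have hq1 : q < 1 := (div_lt_one hy0).2 hy
  rcases (div_nonneg hlam hy0.le).eq_or_lt with hq0 | hq0
  · rw [hq, ← hq0]
    have := Real.rpow_pos_of_pos (hu.pos y) α
    simpa using this
  have h3 : (q ^ m * u z) ^ α ≤ u y ^ α :=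
    Real.rpow_le_rpow (mul_nonneg (by positivity) (hu.pos z).le) hle (by linarith)
  have h4 : (q ^ m * u z) ^ α = q ^ (m * α) * u z ^ α := by
    rw [Real.mul_rpow (by positivity) (hu.pos z).le, ← Real.rpow_natCast, ← Real.rpow_mul hq0.le]
  have h5 : q ^ (m + 4) < q ^ (m * α) := by
    rw [← Real.rpow_natCast]
    exact Real.rpow_lt_rpow_of_exponent_gt hq0 hq1 (by push_cast; exact hαm)
  have h6 := mul_lt_mul_of_pos_right h5 (Real.rpow_pos_of_pos (hu.pos z) α)
  linarith

/-- The comparison defining the moving spheres method holds for the sphere of radius `lam`. -/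
def KelvinLE (u : E (m + 2) → ℝ) (lam : ℝ) : Prop :=
  ∀ y, lam < ‖y‖ → kelvin u lam y ≤ u y

lemma kelvin_lt (hu : IsLaneEmden α u) (hα : 1 < α) (hαm : m * α < m + 4) (hlam : 0 ≤ lam)
    (hP : KelvinLE u lam) {y : E (m + 2)} (hy : lam < ‖y‖) : kelvin u lam y < u y := by
  refine (hP y hy).lt_of_ne fun heq => ?_
  obtain ⟨L, hL0, hL⟩ := hu.hasLapAt_sub_kelvin_neg hα hαm hlam hy heq.le
  refine absurd (hL.nonneg_of_isLocalMin ?_) (not_le.2 hL0)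
  filter_upwards [continuous_norm.continuousAt.eventually_const_lt hy] with x hx
  have := hP x hx
  linarith

lemma kelvin_eq_of_norm_eq (hlam : 0 < lam) {y : E (m + 2)} (hy : ‖y‖ = lam) :
    kelvin u lam y = u y := by
  simp [kelvin, div_self (ne_of_gt hlam), hy]

/-- Twice the derivative at `r = 1` of the function `r ↦ r ^ (m / 2) * u (r • y)`. -/
noncomputable def radial (u : E (m + 2) → ℝ) (y : E (m + 2)) : ℝ :=
  m * u y + 2 * fderiv ℝ u y y

lemma continuous_radial (hu : IsLaneEmden α u) : Continuous (radial u) := by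
  have h1 := hu.contDiff.continuous
  have h2 := hu.contDiff.continuous_fderiv (by norm_num)
  unfold radial
  fun_prop

lemma hasDerivAt_smul_left (hu : IsLaneEmden α u) (y : E (m + 2)) (t : ℝ) :
    HasDerivAt (fun t : ℝ => u (t • y)) (fderiv ℝ u (t • y) y) t := by
  have h := ((hasDerivAt_id t).smul_const y)
  rw [one_smul] at h
  exact ((hu.contDiff.differentiable (by norm_num)) (t • y)).hasFDerivAt.comp_hasDerivAt t h

lemma nonneg_deriv_of_nonneg_right {φ : ℝ → ℝ} {φ' a b : ℝ} (h : HasDerivAt φ φ' a) (hab : a < b)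
    (h0 : φ a = 0) (hφ : ∀ t ∈ Ioo a b, 0 ≤ φ t) : 0 ≤ φ' := by
  have h1 : Tendsto (slope φ a) (𝓝[>] a) (𝓝 φ') :=
    (hasDerivWithinAt_iff_tendsto_slope' (by simp)).1 h.hasDerivWithinAt
  refine ge_of_tendsto h1 ?_
  filter_upwards [Ioo_mem_nhdsGT hab] with t ht
  rw [slope_def_field, h0, sub_zero]
  exact div_nonneg (hφ t ht) (sub_nonneg.2 ht.1.le)

/-- A form of the Hopf boundary lemma for the moving spheres method. -/
lemma radial_pos_of_norm_eq (hu : IsLaneEmden α u) (hm : 0 < m) (hα : 1 < α)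
    (hαm : m * α < m + 4) (hlam : 0 ≤ lam) (hP : KelvinLE u lam) {y : E (m + 2)}
    (hy : ‖y‖ = lam) : 0 < radial u y := by
  rcases hlam.eq_or_lt with h0 | h0
  · rw [← h0, norm_eq_zero] at hy
    have := hu.pos 0
    simp only [radial, hy, map_zero, mul_zero, add_zero]
    positivity
  have hne (z : E (m + 2)) (hz : lam ≤ ‖z‖) : z ≠ 0 := norm_pos_iff.1 (h0.trans_le hz)
  have hcw : ContinuousOn (fun z => u z - kelvin u lam z) {z | z ≠ 0} :=
    hu.contDiff.continuous.continuousOn.sub (hu.continuousOn_kelvin lam)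
  obtain ⟨z, hz, hmin⟩ := (isCompact_sphere (0 : E (m + 2)) (2 * lam)).exists_isMinOn
    (NormedSpace.sphere_nonempty.2 (by positivity))
    (hcw.mono fun x hx => hne x (by rw [mem_sphere_zero_iff_norm.1 hx]; linarith))
  have hz' : ‖z‖ = 2 * lam := by simpa using hz
  set ε := u z - kelvin u lam z with hε
  have hε0 : 0 < ε := sub_pos.2 (hu.kelvin_lt hα hαm hlam hP (by linarith))
  have hbar (x : E (m + 2)) (h1 : lam ≤ ‖x‖) (h2 : ‖x‖ ≤ 2 * lam) :
      0 ≤ (u x - kelvin u lam x) + (ε * (lam / ‖x‖) ^ m + -ε) := by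
    refine nonneg_of_annulus
      (f := fun x => (u x - kelvin u lam x) + (ε * (lam / ‖x‖) ^ m + -ε)) ?_ ?_ ?_ ?_ h1 h2
    · refine (hcw.mono fun x hx => hne x hx.1).add
        ((continuousOn_const.mul ?_).add continuousOn_const)
      exact (continuousOn_const.div continuous_norm.continuousOn
        fun x hx => (h0.trans_le hx.1).ne').pow m
    · intro x hx _
      obtain ⟨L, hL0, hL⟩ := hu.hasLapAt_sub_kelvin_neg hα hαm hlam hx (hP x hx)
      exact ⟨_, by simpa using hL0, hL.add
        (((hasLapAt_div_norm_pow lam (hne x hx.le)).const_mul ε).add (HasLapAt.const (-ε)))⟩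
    · intro x hx
      simp [kelvin_eq_of_norm_eq h0 hx, hx, div_self h0.ne']
    · intro x hx
      have h3 : ε ≤ u x - kelvin u lam x := hmin (by simpa using hx)
      have h4 : 0 ≤ ε * (lam / ‖x‖) ^ m := by positivity
      linarith
  have hd : HasDerivAt (fun t : ℝ => (u (t • y) - t⁻¹ ^ m * u (t⁻¹ • y)) + (ε * t⁻¹ ^ m + -ε))
      (radial u y - ε * m) 1 := by
    have hi : HasDerivAt (fun t : ℝ => t⁻¹) (-1) 1 := by
      simpa using hasDerivAt_inv (one_ne_zero (α := ℝ))
    have hip : HasDerivAt (fun t : ℝ => t⁻¹ ^ m) (-m) 1 :=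
      hasDerivAt_of_eq (hi.pow m) (fun t => rfl) (by simp)
    have h1 := hu.hasDerivAt_smul_left y 1
    have h2 : HasDerivAt (fun t : ℝ => u (t⁻¹ • y)) (fderiv ℝ u ((1 : ℝ)⁻¹ • y) y * -1) 1 :=
      (hu.hasDerivAt_smul_left y (1 : ℝ)⁻¹).comp (1 : ℝ) hi
    refine hasDerivAt_of_eq
      ((h1.sub (hip.mul h2)).add ((hip.const_mul ε).add_const (-ε))) (fun t => rfl) ?_
    simp [radial]
    ring
  have hnn := nonneg_deriv_of_nonneg_right hd one_lt_two (by simp) fun t ht => by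
    have ht0 : 0 < t := one_pos.trans ht.1
    have hn : ‖t • y‖ = t * lam := by rw [norm_smul, hy, Real.norm_of_nonneg ht0.le]
    have h1 := hbar (t • y) (by rw [hn]; nlinarith [ht.1]) (by rw [hn]; nlinarith [ht.2])
    have h2 : lam / ‖t • y‖ = t⁻¹ := by rw [hn]; field_simp
    have h3 : (t⁻¹ ^ 2 * t) = t⁻¹ := by field_simp
    rwa [kelvin, h2, smul_smul, h3] at h1
  have : 0 < ε * m := by positivity
  linarith

lemma exists_shell_radial_pos (hu : IsLaneEmden α u) (hm : 0 < m) (hα : 1 < α)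
    (hαm : m * α < m + 4) (hlam : 0 ≤ lam) (hP : KelvinLE u lam) :
    ∃ δ > 0, ∀ z : E (m + 2), lam - δ < ‖z‖ → ‖z‖ < lam + δ → 0 < radial u z := by
  have hK := isCompact_sphere (0 : E (m + 2)) 1
  have hev : ∀ᶠ r in 𝓝 lam, ∀ θ ∈ sphere (0 : E (m + 2)) 1, 0 < radial u (r • θ) := by
    refine hK.eventually_forall_of_forall_eventually fun θ hθ => ?_
    have hc : Continuous fun p : ℝ × E (m + 2) => radial u (p.1 • p.2) :=
      hu.continuous_radial.comp (continuous_fst.smul continuous_snd)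
    refine hc.continuousAt.eventually_const_lt (hu.radial_pos_of_norm_eq hm hα hαm hlam hP ?_)
    have : ‖θ‖ = 1 := by simpa using hθ
    simp [norm_smul, this, abs_of_nonneg hlam]
  obtain ⟨δ, hδ, h⟩ := Metric.eventually_nhds_iff.1 hev
  refine ⟨δ, hδ, fun z h1 h2 => ?_⟩
  have hr := @h ‖z‖ (by rw [Real.dist_eq, abs_lt]; constructor <;> linarith)
  rcases eq_or_ne z 0 with rfl | hz
  · obtain ⟨θ, hθ⟩ := NormedSpace.sphere_nonempty (x := (0 : E (m + 2))).2 zero_le_one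
    simpa using hr θ hθ
  · have hz0 := norm_ne_zero_iff.2 hz
    simpa [smul_smul, hz0] using hr (‖z‖⁻¹ • z) (by simp [norm_smul, hz0])

lemma kelvin_le_of_radial_pos (hu : IsLaneEmden α u) (hm : 0 < m) {a b : ℝ}
    (h : ∀ z : E (m + 2), a < ‖z‖ → ‖z‖ < b → 0 < radial u z) (hlam : 0 ≤ lam) {y : E (m + 2)}
    (hy : lam < ‖y‖) (ha : a < lam ^ 2 / ‖y‖) (hb : ‖y‖ < b) : kelvin u lam y ≤ u y := by
  have hy0 : 0 < ‖y‖ := hlam.trans_lt hy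
  set q := lam / ‖y‖ with hq
  have hq0 : 0 ≤ q := div_nonneg hlam hy0.le
  have hq1 : q < 1 := (div_lt_one hy0).2 hy
  have hd (t : ℝ) : HasDerivAt (fun t : ℝ => t ^ m * u (t • y) ^ 2)
      (t ^ (m - 1) * u (t • y) * radial u (t • y)) t := by
    refine hasDerivAt_of_eq ((hasDerivAt_pow m t).mul ((hu.hasDerivAt_smul_left y t).pow 2))
      (fun t => rfl) ?_
    obtain ⟨k, rfl⟩ := Nat.exists_eq_succ_of_ne_zero hm.ne'
    simp [radial]
    ring
  have hmono : MonotoneOn (fun t : ℝ => t ^ m * u (t • y) ^ 2) (Icc (q ^ 2) 1) := by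
    refine monotoneOn_of_deriv_nonneg (convex_Icc _ _)
      (fun t _ => (hd t).continuousAt.continuousWithinAt)
      (fun t _ => (hd t).differentiableAt.differentiableWithinAt) fun t ht => ?_
    rw [interior_Icc] at ht
    have ht0 : 0 < t := (sq_nonneg q).trans_lt ht.1
    have hn : ‖t • y‖ = t * ‖y‖ := by rw [norm_smul, Real.norm_of_nonneg ht0.le]
    have h1 : lam ^ 2 / ‖y‖ = q ^ 2 * ‖y‖ := by rw [hq]; field_simp
    have h2 := h (t • y) (by rw [hn]; nlinarith [ht.1]) (by rw [hn]; nlinarith [ht.2])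
    have h3 := hu.pos (t • y)
    rw [(hd t).deriv]
    positivity
  have hsq : q ^ 2 ≤ 1 := by nlinarith
  have h1 := hmono (left_mem_Icc.2 hsq) (right_mem_Icc.2 hsq) hsq
  simp only [one_pow, one_smul, one_mul] at h1
  refine le_of_sq_le_sq ?_ (hu.pos y).le
  calc kelvin u lam y ^ 2 = (q ^ 2) ^ m * u (q ^ 2 • y) ^ 2 := by rw [kelvin]; ring
    _ ≤ _ := h1

lemma eventually_kelvinLE (hu : IsLaneEmden α u) (hm : 0 < m) (hα : 1 < α)
    (hαm : m * α < m + 4) (hlam : 0 ≤ lam) (hP : KelvinLE u lam) :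
    ∀ᶠ μ in 𝓝[>] lam, KelvinLE u μ := by
  obtain ⟨δ, hδ, hshell⟩ := hu.exists_shell_radial_pos hm hα hαm hlam hP
  set a := lam + δ / 2 with ha
  have ha0 : 0 < a := by positivity
  obtain ⟨c, hc, hfar⟩ := exists_decay_lower_bound hm ha0
    (f := fun z => u z - kelvin u lam z)
    ((hu.contDiff.continuous.continuousOn.sub (hu.continuousOn_kelvin lam)).mono
      fun z hz => norm_pos_iff.1 (ha0.trans_le hz))
    (fun y hy => hu.hasLapAt_sub_kelvin_neg hα hαm hlam (by linarith) (hP y (by linarith)))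
    (fun y hy => sub_nonneg.2 (hP y (by linarith)))
    (fun y hy => sub_pos.2 (hu.kelvin_lt hα hαm hlam hP (by linarith)))
  have hev : ∀ᶠ μ in 𝓝 lam, ∀ z ∈ closedBall (0 : E (m + 2)) (1 / a),
      μ ^ m * u (μ ^ 2 • z) < lam ^ m * u (lam ^ 2 • z) + c := by
    refine (isCompact_closedBall _ _).eventually_forall_of_forall_eventually fun z _ => ?_
    have hcu := hu.contDiff.continuous
    have h1 : Continuous fun p : ℝ × E (m + 2) => p.1 ^ m * u (p.1 ^ 2 • p.2) := by fun_prop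
    have h2 : Continuous fun p : ℝ × E (m + 2) => lam ^ m * u (lam ^ 2 • p.2) + c := by fun_prop
    exact h1.continuousAt.eventually_lt h2.continuousAt (by simpa using hc)
  filter_upwards [nhdsWithin_le_nhds hev, self_mem_nhdsWithin] with μ hμ hlt y hy
  have hlt : lam < μ := hlt
  have hy0 : 0 < ‖y‖ := by linarith
  rcases lt_or_ge ‖y‖ a with h | h
  · refine hu.kelvin_le_of_radial_pos hm hshell (by linarith) hy ?_ (by linarith)
    rw [lt_div_iff₀ hy0]
    rcases le_or_gt (lam - δ) 0 with h1 | h1 <;> nlinarith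
  · have hk (ν : ℝ) : kelvin u ν y =
        (1 / ‖y‖) ^ m * (ν ^ m * u (ν ^ 2 • ((1 / ‖y‖) ^ 2 • y))) := by
      rw [kelvin, smul_smul, ← mul_pow, mul_one_div, ← mul_assoc, ← mul_pow, mul_comm (1 / ‖y‖),
        mul_one_div]
    have hz : (1 / ‖y‖) ^ 2 • y ∈ closedBall (0 : E (m + 2)) (1 / a) := by
      have : ‖(1 / ‖y‖) ^ 2 • y‖ = 1 / ‖y‖ := by
        rw [norm_smul, Real.norm_of_nonneg (by positivity)]; field_simp
      rw [mem_closedBall_zero_iff, this]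
      exact one_div_le_one_div_of_le ha0 h
    have h1 := hfar y h
    have h2 := mul_le_mul_of_nonneg_left (hμ _ hz).le (by positivity : 0 ≤ (1 / ‖y‖) ^ m)
    rw [mul_add, ← hk, ← hk] at h2
    linarith

lemma kelvinLE (hu : IsLaneEmden α u) (hm : 0 < m) (hα : 1 < α) (hαm : m * α < m + 4)
    (hlam : 0 ≤ lam) : KelvinLE u lam := by
  have hclosed : IsClosed {ν | KelvinLE u ν} := by
    rw [← isOpen_compl_iff, isOpen_iff_eventually]
    intro ν hν
    simp only [KelvinLE, mem_compl_iff, mem_ofPred_eq, not_forall, not_le] at hν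
    obtain ⟨y, hy, hlt⟩ := hν
    have hcu := hu.contDiff.continuous
    have hk : Continuous fun ν : ℝ => kelvin u ν y := by unfold kelvin; fun_prop
    filter_upwards [eventually_lt_nhds hy, hk.continuousAt.eventually_const_lt hlt] with μ h1 h2 hμ
    exact (hμ y h1).not_gt h2
  have h0 : KelvinLE u 0 := fun y _ => by simpa [kelvin, hm.ne'] using (hu.pos y).le
  refine (hclosed.inter isClosed_Icc).Icc_subset_of_forall_exists_gt (a := 0) (b := lam) h0
    (fun ν hν μ hμ => ?_) (right_mem_Icc.2 hlam)
  exact ((hu.eventually_kelvinLE hm hα hαm hν.2.1 hν.1).and (Ioc_mem_nhdsGT hμ)).exists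

lemma apply_le_apply (hu : IsLaneEmden α u) (hm : 0 < m) (hα : 1 < α) (hαm : m * α < m + 4)
    (a b : E (m + 2)) : u b ≤ u a := by
  rcases eq_or_ne a b with rfl | hab
  · rfl
  have key : ∀ t ∈ Ioo (0 : ℝ) 1, t ^ m * u b ≤ u a := by
    intro t ht
    have hs : 1 - t ^ 2 ≠ 0 := by nlinarith [ht.1, ht.2]
    set y := (1 - t ^ 2)⁻¹ • (a - b) with hy
    have hy0 : 0 < ‖y‖ := norm_pos_iff.2 (smul_ne_zero (inv_ne_zero hs) (sub_ne_zero.2 hab))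
    have h1 := (hu.translate (a - y)).kelvinLE hm hα hαm (lam := t * ‖y‖)
      (mul_nonneg ht.1.le hy0.le) y (by nlinarith [ht.2])
    have h2 : (1 - t ^ 2) • y = a - b := by rw [hy, smul_smul, mul_inv_cancel₀ hs, one_smul]
    have h3 : a - y + t ^ 2 • y = b := by
      rw [sub_smul, one_smul] at h2
      rw [← sub_sub_cancel a b, ← h2]; abel
    rw [kelvin, mul_div_cancel_right₀ _ hy0.ne', h3] at h1
    simpa using h1
  have hlim : Tendsto (fun t : ℝ => t ^ m * u b) (𝓝[<] 1) (𝓝 (u b)) := by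
    have : Continuous fun t : ℝ => t ^ m * u b := by fun_prop
    simpa using (this.tendsto 1).mono_left nhdsWithin_le_nhds
  exact le_of_tendsto hlim (by filter_upwards [Ioo_mem_nhdsLT one_pos] with t ht using key t ht)

/-- There is no solution attaining its infimum. -/
lemma not_forall_ge {n : ℕ} {α : ℝ} {u : E n → ℝ} (hu : IsLaneEmden α u) (a : E n) :
    ¬ ∀ x, u a ≤ u x := fun h =>
  (hu.lap_neg a).not_ge
    ((hasLapAt_lap hu.contDiff a).nonneg_of_isLocalMin (Eventually.of_forall h))

lemma false_of_subcritical (hu : IsLaneEmden α u) (hm : 0 < m) (hα : 1 < α)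
    (hαm : m * α < m + 4) : False :=
  hu.not_forall_ge 0 fun x => hu.apply_le_apply hm hα hαm x 0

lemma false_of_dim_le_two {n : ℕ} {α : ℝ} {u : E n → ℝ} (hu : IsLaneEmden α u) (hn : n ≤ 2) :
    False := by
  have hcu := hu.contDiff.continuous
  obtain ⟨a, _, hmin⟩ := (isCompact_closedBall (0 : E n) 1).exists_isMinOn
    ⟨0, by simp⟩ hcu.continuousOn
  refine hu.not_forall_ge a fun x => ?_
  rcases le_or_gt ‖x‖ 1 with hx | hx
  · exact hmin (by simpa using hx)
  have hlog : 0 < Real.log ‖x‖ := Real.log_pos hx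
  refine le_of_forall_pos_le_add fun δ hδ => ?_
  set ε := δ / Real.log ‖x‖ with hε
  have hε0 : 0 < ε := div_pos hδ hlog
  have hεx : ε * Real.log ‖x‖ = δ := div_mul_cancel₀ _ hlog.ne'
  obtain ⟨R, hRlog, hRx⟩ := (((Real.tendsto_log_atTop.const_mul_atTop hε0).eventually_ge_atTop
    (u a)).and (eventually_ge_atTop ‖x‖)).exists
  have key := nonneg_of_annulus (a := 1) (b := R)
    (f := fun z => (u z + ε * Real.log ‖z‖) + -u a) ?_ ?_ ?_ ?_ hx.le hRx
  · linarith
  · refine (hcu.continuousOn.add (continuousOn_const.mul ?_)).add continuousOn_const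
    exact continuous_norm.continuousOn.log fun z hz => (one_pos.trans_le hz.1).ne'
  · intro z hz _
    have hz0 : z ≠ 0 := norm_pos_iff.1 (one_pos.trans hz)
    refine ⟨_, ?_, ((hasLapAt_lap hu.contDiff z).add ((hasLapAt_log_norm hz0).const_mul ε)).add
      (HasLapAt.const _)⟩
    have h1 := hu.lap_neg z
    have h2 : ((n : ℝ) - 2) ≤ 0 := by
      have : (n : ℝ) ≤ 2 := by exact_mod_cast hn
      linarith
    have h3 : ε * (((n : ℝ) - 2) * ‖z‖⁻¹ ^ 2) ≤ 0 :=
      mul_nonpos_of_nonneg_of_nonpos hε0.le (mul_nonpos_of_nonpos_of_nonneg h2 (by positivity))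
    linarith
  · intro z hz
    have h1 : u a ≤ u z := hmin (by simpa using hz.le)
    simpa [hz] using h1
  · intro z hz
    have := hu.pos z
    rw [hz]; linarith

end IsLaneEmden

/-- Gidas–Spruck type Liouville theorem: no positive global solution of
`Δu + u^α = 0` on ℝⁿ for `α ∈ (1, p_S(n))`. -/
theorem stmt5 (n : ℕ) (hn : 0 < n) (α : ℝ) (hα : 1 < α)
    (hαp : 2 < n → α < ((n : ℝ) + 2) / ((n : ℝ) - 2)) :
    ¬ ∃ u : E n → ℝ, ContDiff ℝ 2 u ∧ (∀ x, 0 < u x) ∧ ∀ x, lap u x + u x ^ α = 0 := by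
  rintro ⟨u, h1, h2, h3⟩
  have hu : IsLaneEmden α u := ⟨h1, h2, h3⟩
  rcases le_or_gt n 2 with h | h
  · exact hu.false_of_dim_le_two h
  obtain ⟨m, rfl⟩ := Nat.exists_eq_add_of_le' h.le
  have hm : 0 < m := by omega
  have hm' : (0 : ℝ) < m := by exact_mod_cast hm
  refine hu.false_of_subcritical hm hα ?_
  have h4 := hαp h
  push_cast at h4
  rw [lt_div_iff₀ (by linarith)] at h4
  linarith
end
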